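/- Let X, Y be real D×N matrices, and let |X| = (XᵀX)^{1/2} and |Y| = (YᵀY)^{1/2} denote the unique N×N positive semidefinite square roots of their Gram matrices. Then ‖ |X| − |Y| ‖_F² ≤ √(2D) · ‖XᵀX − YᵀY‖_F. -/

import Mathlib

open Matrix

/-- The Frobenius norm of a real matrix: `‖A‖_F = (Σ_{i,j} A_{ij}²)^{1/2}`. -/
noncomputable def frobNorm {m n : Type*} [Fintype m] [Fintype n] (A : Matrix m n ℝ) : ℝ :=
  Real.sqrt (∑ i, ∑ j, (A i j) ^ 2)

theorem frobNorm_sq {m n : Type*} [Fintype m] [Fintype n] (A : Matrix m n ℝ) :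
    frobNorm A ^ 2 = ∑ i, ∑ j, A i j ^ 2 :=
  Real.sq_sqrt (Finset.sum_nonneg fun _ _ => Finset.sum_nonneg fun _ _ => sq_nonneg _)

theorem frobNorm_sq_eq_trace {m n : Type*} [Fintype m] [Fintype n] (A : Matrix m n ℝ) :
    frobNorm A ^ 2 = (Aᵀ * A).trace := by
  rw [frobNorm_sq, Finset.sum_comm]
  simp [Matrix.trace, Matrix.mul_apply, sq]

theorem frobNorm_nonneg {m n : Type*} [Fintype m] [Fintype n] (A : Matrix m n ℝ) :
    0 ≤ frobNorm A :=
  Real.sqrt_nonneg _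

/-- The Frobenius norm is invariant under orthogonal conjugation. -/
theorem frobNorm_conj {n : Type*} [Fintype n] [DecidableEq n] {U : Matrix n n ℝ}
    (hU : U * Uᵀ = 1) (A : Matrix n n ℝ) : frobNorm (Uᵀ * A * U) = frobNorm A := by
  rw [← sq_eq_sq₀ (frobNorm_nonneg _) (frobNorm_nonneg _), frobNorm_sq_eq_trace,
    frobNorm_sq_eq_trace]
  have h : (Uᵀ * A * U)ᵀ * (Uᵀ * A * U) = Uᵀ * (Aᵀ * A * U) := by
    calc (Uᵀ * A * U)ᵀ * (Uᵀ * A * U) = Uᵀ * Aᵀ * (U * Uᵀ) * A * U := by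
          simp only [transpose_mul, transpose_transpose, Matrix.mul_assoc]
      _ = Uᵀ * (Aᵀ * A * U) := by rw [hU]; simp only [Matrix.mul_one, Matrix.mul_assoc]
  rw [h, trace_mul_comm, Matrix.mul_assoc, hU, Matrix.mul_one]

/-- If `A` and `B` have nonnegative diagonals and differ by a diagonal matrix, the squared entries
of the difference are bounded by the diagonal entries of `A² - B²`. -/
theorem sq_le_abs_diag_of_sub_eq_diagonal {n : Type*} [Fintype n] [DecidableEq n]
    {A B : Matrix n n ℝ} {d : n → ℝ} (hA : ∀ i, 0 ≤ A i i) (hB : ∀ i, 0 ≤ B i i)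
    (h : A - B = diagonal d) (i : n) : d i ^ 2 ≤ |(A * A - B * B) i i| := by
  have hd : A i i - B i i = d i := by
    simpa using congrFun (congrFun h i) i
  have hM : (A * A - B * B) i i = d i * (A i i + B i i) := by
    have : A * A - B * B = diagonal d * A + B * diagonal d := by
      rw [← h]; noncomm_ring
    rw [this, Matrix.add_apply, diagonal_mul, mul_diagonal]
    ring
  rw [hM, abs_mul, ← sq_abs, sq]
  refine mul_le_mul_of_nonneg_left ?_ (abs_nonneg _)
  rw [← hd, abs_of_nonneg (add_nonneg (hA i) (hB i)), abs_le]
  constructor <;> linarith [hA i, hB i]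

theorem sum_diag_sq_le_frobNorm_sq {n : Type*} [Fintype n] (M : Matrix n n ℝ) (s : Finset n) :
    ∑ i ∈ s, M i i ^ 2 ≤ frobNorm M ^ 2 := by
  rw [frobNorm_sq]
  calc ∑ i ∈ s, M i i ^ 2 ≤ ∑ i, M i i ^ 2 :=
        Finset.sum_le_sum_of_subset_of_nonneg (Finset.subset_univ _) fun _ _ _ => sq_nonneg _
    _ ≤ ∑ i, ∑ j, M i j ^ 2 := Finset.sum_le_sum fun i _ =>
        Finset.single_le_sum (f := fun j => M i j ^ 2) (fun _ _ => sq_nonneg _)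
          (Finset.mem_univ i)

/-- A rank-sensitive form of the Powers–Størmer inequality in the Frobenius norm. -/
theorem frobNorm_sub_sq_le_sqrt_rank {n : Type*} [Fintype n] [DecidableEq n]
    {A B : Matrix n n ℝ} (hA : A.PosSemidef) (hB : B.PosSemidef) :
    frobNorm (A - B) ^ 2 ≤ Real.sqrt (A - B).rank * frobNorm (A * A - B * B) := by
  have hC : (A - B).IsHermitian := hA.isHermitian.sub hB.isHermitian
  set U : Matrix n n ℝ := hC.eigenvectorUnitary.1
  set d := hC.eigenvalues
  have hU : U * Uᵀ = 1 := by
    simpa [star_eq_conjTranspose] using Unitary.coe_mul_star_self hC.eigenvectorUnitary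
  have hdiag : Uᵀ * A * U - Uᵀ * B * U = diagonal d := by
    have h := hC.conjStarAlgAut_star_eigenvectorUnitary
    rw [Unitary.conjStarAlgAut_star_apply] at h
    rw [← Matrix.sub_mul, ← Matrix.mul_sub]
    simpa [star_eq_conjTranspose, Function.comp_def] using h
  have hsq (P : Matrix n n ℝ) : Uᵀ * P * U * (Uᵀ * P * U) = Uᵀ * (P * P) * U := by
    calc Uᵀ * P * U * (Uᵀ * P * U) = Uᵀ * P * (U * Uᵀ) * P * U := by
          simp only [Matrix.mul_assoc]
      _ = Uᵀ * (P * P) * U := by rw [hU]; simp only [Matrix.mul_one, Matrix.mul_assoc]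
  set M := Uᵀ * A * U * (Uᵀ * A * U) - Uᵀ * B * U * (Uᵀ * B * U) with hM
  have hMnorm : frobNorm M = frobNorm (A * A - B * B) := by
    rw [hM, hsq, hsq, ← Matrix.sub_mul, ← Matrix.mul_sub, frobNorm_conj hU]
  have hnonneg {P : Matrix n n ℝ} (hP : P.PosSemidef) (i : n) : 0 ≤ (Uᵀ * P * U) i i := by
    simpa using (hP.conjTranspose_mul_mul_same U).diag_nonneg (i := i)
  have hle (i : n) : d i ^ 2 ≤ |M i i| :=
    sq_le_abs_diag_of_sub_eq_diagonal (hnonneg hA) (hnonneg hB) hdiag i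
  set s : Finset n := {i | d i ≠ 0} with hs
  have hcard : (s.card : ℝ) = (A - B).rank := by
    rw [hC.rank_eq_card_non_zero_eigs, Fintype.card_subtype]
  have hleft : frobNorm (A - B) ^ 2 = ∑ i ∈ s, d i ^ 2 := by
    rw [← frobNorm_conj hU, Matrix.mul_sub, Matrix.sub_mul, hdiag, frobNorm_sq_eq_trace,
      diagonal_transpose, diagonal_mul_diagonal, trace_diagonal]
    simp only [← sq]
    refine (Finset.sum_subset (Finset.subset_univ s) fun i _ hi => ?_).symm
    simpa [hs] using hi
  calc frobNorm (A - B) ^ 2 ≤ ∑ i ∈ s, 1 * |M i i| := by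
        rw [hleft]
        simpa using Finset.sum_le_sum fun i (_ : i ∈ s) => hle i
    _ ≤ Real.sqrt (∑ _i ∈ s, 1 ^ 2) * Real.sqrt (∑ i ∈ s, |M i i| ^ 2) :=
        Real.sum_mul_le_sqrt_mul_sqrt _ _ _
    _ ≤ Real.sqrt (A - B).rank * frobNorm (A * A - B * B) := by
        rw [← hMnorm, ← hcard]
        simp only [one_pow, Finset.sum_const, nsmul_eq_mul, mul_one, sq_abs]
        exact mul_le_mul_of_nonneg_left
          (Real.sqrt_le_iff.2 ⟨frobNorm_nonneg _, sum_diag_sq_le_frobNorm_sq M s⟩)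
          (Real.sqrt_nonneg _)

theorem rank_add_le_rank_add_rank {m n K : Type*} [Fintype m] [Fintype n] [Field K]
    (A B : Matrix m n K) : (A + B).rank ≤ A.rank + B.rank := by
  unfold Matrix.rank
  rw [mulVecLin_add]
  exact (Submodule.finrank_mono (LinearMap.range_add_le _ _)).trans
    (Submodule.finrank_add_le_finrank_add_finrank _ _)

theorem rank_eq_of_mul_self_eq_transpose_mul_self {m n : Type*} [Fintype m] [Fintype n]
    {A : Matrix n n ℝ} {X : Matrix m n ℝ} (hA : A.IsHermitian) (h : A * A = Xᵀ * X) :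
    A.rank = X.rank := by
  rw [← rank_transpose_mul_self X, ← h, ← rank_conjTranspose_mul_self A, hA.eq]

/-- **Matrix absolute values are stable.** If `|X| = (XᵀX)^{1/2}` and `|Y| = (YᵀY)^{1/2}`
are the (unique) positive semidefinite square roots of the Gram matrices of `X` and `Y`,
then `‖ |X| − |Y| ‖_F² ≤ √(2D) ‖XᵀX − YᵀY‖_F`. -/
theorem abs_diff_frob_sq_le (D N : ℕ)
    (X Y : Matrix (Fin D) (Fin N) ℝ)
    (absX absY : Matrix (Fin N) (Fin N) ℝ)
    (hXpsd : absX.PosSemidef) (hYpsd : absY.PosSemidef)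
    (hXsq : absX * absX = Xᵀ * X) (hYsq : absY * absY = Yᵀ * Y) :
    frobNorm (absX - absY) ^ 2 ≤ Real.sqrt (2 * D) * frobNorm (Xᵀ * X - Yᵀ * Y) := by
  have hrank : (absX - absY).rank ≤ 2 * D := by
    have hX : absX.rank ≤ D := by
      rw [rank_eq_of_mul_self_eq_transpose_mul_self hXpsd.isHermitian hXsq]
      exact X.rank_le_height
    have hY : (-absY).rank ≤ D := by
      rw [rank_eq_of_mul_self_eq_transpose_mul_self hYpsd.isHermitian.neg
        (X := Y) (by rw [neg_mul_neg, hYsq])]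
      exact Y.rank_le_height
    have hadd := rank_add_le_rank_add_rank absX (-absY)
    rw [← sub_eq_add_neg] at hadd
    omega
  rw [← hXsq, ← hYsq]
  refine (frobNorm_sub_sq_le_sqrt_rank hXpsd hYpsd).trans
    (mul_le_mul_of_nonneg_right (Real.sqrt_le_sqrt ?_) (frobNorm_nonneg _))
  exact_mod_cast hrank
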